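/- The block-pairwise asynchronous cellular automaton model is strongly (non-committally) intrinsically universal: there exists a fixed block-pairwise ACA rule set such that every block-pairwise ACA system Γ = (Σ, S, Δ, C) is non-committally simulated, under a block representation function mapping each cell of Γ to a block of cells of the universal system, by a system using that fixed rule set with a suitable initial configuration. -/

import Mathlib

open scoped Classical

/-- Positions in the plane. -/
abbrev Pos : Type := ℤ × ℤ

/-- A (total) configuration of a 2D cellular automaton, with states encoded as naturals. -/
abbrev Config : Type := Pos → ℕ

/-- The four cardinal directions, as offsets. -/
def dirOffset : Fin 4 → Pos
  | 0 => (1, 0)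
  | 1 => (-1, 0)
  | 2 => (0, 1)
  | 3 => (0, -1)

/-- A block-pairwise asynchronous cellular automaton: rules `(σ1, σ2, d, σ1', σ2')`
update a cell in state `σ1` and its cardinal neighbour in direction `d` in state `σ2`
simultaneously to `σ1'` and `σ2'`. -/
structure BPACA where
  states : Finset ℕ
  rules : Finset (ℕ × ℕ × Fin 4 × ℕ × ℕ)
  init : Config
  init_states : ∀ p : Pos, init p ∈ states
  rules_states : ∀ r ∈ rules,
    r.1 ∈ states ∧ r.2.1 ∈ states ∧ r.2.2.2.1 ∈ states ∧ r.2.2.2.2 ∈ states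

/-- One asynchronous rule application of a block-pairwise ACA. -/
def BPACA.StepR (Γ : BPACA) (C C' : Config) : Prop :=
  ∃ r ∈ Γ.rules, ∃ p : Pos,
    C p = r.1 ∧ C (p + dirOffset r.2.2.1) = r.2.1 ∧
    C' = Function.update (Function.update C p r.2.2.2.1)
          (p + dirOffset r.2.2.1) r.2.2.2.2

/-- Reachability by asynchronous updates. -/
def BPACA.Reach (Γ : BPACA) : Config → Config → Prop :=
  Relation.ReflTransGen Γ.StepR

/-- The reachable configurations of a block-pairwise ACA. -/
def BPACA.Reachable (Γ : BPACA) (C : Config) : Prop := Γ.Reach Γ.init C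

/-- A pairwise asynchronous cellular automaton: rules `(σ1, σ2, d, σ1')` update only
the first cell of a pair consisting of a cell in state `σ1` and its cardinal
neighbour in direction `d` in state `σ2`. -/
structure PACA where
  states : Finset ℕ
  rules : Finset (ℕ × ℕ × Fin 4 × ℕ)
  init : Config
  init_states : ∀ p : Pos, init p ∈ states
  rules_states : ∀ r ∈ rules, r.1 ∈ states ∧ r.2.1 ∈ states ∧ r.2.2.2 ∈ states

/-- One asynchronous rule application of a pairwise ACA. -/
def PACA.StepR (Γ : PACA) (C C' : Config) : Prop :=
  ∃ r ∈ Γ.rules, ∃ p : Pos,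
    C p = r.1 ∧ C (p + dirOffset r.2.2.1) = r.2.1 ∧
    C' = Function.update C p r.2.2.2

/-- Reachability by asynchronous updates. -/
def PACA.Reach (Γ : PACA) : Config → Config → Prop :=
  Relation.ReflTransGen Γ.StepR

/-- The reachable configurations of a pairwise ACA. -/
def PACA.Reachable (Γ : PACA) (C : Config) : Prop := Γ.Reach Γ.init C

/-- An `m`-block of simulator states. -/
abbrev CBlock (m : ℕ) : Type := Fin m × Fin m → ℕ

/-- The `m`-block of configuration `C` at block coordinates `(x, y)`. -/
def cblockAt (m : ℕ) (C : Config) (x y : ℤ) : CBlock m :=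
  fun ij => C ((m : ℤ) * x + (ij.1.1 : ℤ), (m : ℤ) * y + (ij.2.1 : ℤ))

/-- `D = R*(C)`: `D` is the blockwise image of the configuration `C` under the
`m`-block representation function `R`. -/
def CRepMap (m : ℕ) (R : CBlock m → ℕ) (C D : Config) : Prop :=
  ∀ x y : ℤ, D (x, y) = R (cblockAt m C x y)

/-- Non-committal simulation of a block-pairwise ACA `ΓT` by a block-pairwise ACA `ΓS`
under the `m`-block representation function `R`: equivalent productions, follows,
and non-committally models. -/
def BPACASimulates (m : ℕ) (R : CBlock m → ℕ) (ΓS ΓT : BPACA) : Prop :=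
  0 < m ∧
  (∀ C', ΓS.Reachable C' → ∃ C, ΓT.Reachable C ∧ CRepMap m R C' C) ∧
  (∀ C, ΓT.Reachable C → ∃ C', ΓS.Reachable C' ∧ CRepMap m R C' C) ∧
  (∀ C' D', ΓS.Reachable C' → ΓS.Reach C' D' →
    ∀ C D, CRepMap m R C' C → CRepMap m R D' D → ΓT.Reach C D) ∧
  (∀ C D, ΓT.Reachable C → ΓT.Reach C D →
    ∀ C', ΓS.Reachable C' → CRepMap m R C' C →
      ∃ D', ΓS.Reach C' D' ∧ CRepMap m R D' D)

/-- Non-committal simulation of a pairwise ACA `ΓT` by a pairwise ACA `ΓS`. -/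
def PACASimulates (m : ℕ) (R : CBlock m → ℕ) (ΓS ΓT : PACA) : Prop :=
  0 < m ∧
  (∀ C', ΓS.Reachable C' → ∃ C, ΓT.Reachable C ∧ CRepMap m R C' C) ∧
  (∀ C, ΓT.Reachable C → ∃ C', ΓS.Reachable C' ∧ CRepMap m R C' C) ∧
  (∀ C' D', ΓS.Reachable C' → ΓS.Reach C' D' →
    ∀ C D, CRepMap m R C' C → CRepMap m R D' D → ΓT.Reach C D) ∧
  (∀ C D, ΓT.Reachable C → ΓT.Reach C D →
    ∀ C', ΓS.Reachable C' → CRepMap m R C' C →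
      ∃ D', ΓS.Reach C' D' ∧ CRepMap m R D' D)

namespace IU

/-- Tokens: (direction, role, committed?). -/
abbrev Tok : Type := Fin 4 × Bool × Bool

/-- Cells of the universal system: switch table, wall bits, token. -/
abbrev Cell : Type := (Tok → Tok → Bool) × (Fin 4 → Bool) × Option Tok

noncomputable def enc (k : Cell) : ℕ := (Fintype.equivFin Cell k).val

theorem enc_inj {a b : Cell} (h : enc a = enc b) : a = b :=
  (Fintype.equivFin Cell).injective (Fin.ext h)

/-- Is the direction horizontal? -/
def ax : Fin 4 → Bool
  | 0 => true
  | 1 => true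
  | 2 => false
  | 3 => false

inductive Good : Cell → Cell → Fin 4 → Cell → Cell → Prop
  | move (M w M' w' t d) : ax t.1 = ax d → w d = true →
      Good (M, w, some t) (M', w', none) d (M, w, none) (M', w', some t)
  | switch (M w k t t' d) : M t t' = true →
      Good (M, w, some t) k d (M, w, some t') k
  | commit (M w M' w' d) :
      Good (M, w, some (d, false, false)) (M', w', some (d, true, false)) d
        (M, w, some (d, false, true)) (M', w', some (d, true, true))

noncomputable def StU : Finset ℕ := Set.Finite.toFinset (Set.finite_range enc)

theorem mem_StU (k : Cell) : enc k ∈ StU := by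
  simp [StU]

def ruleSet : Set (ℕ × ℕ × Fin 4 × ℕ × ℕ) :=
  {r | ∃ a b d a' b', Good a b d a' b' ∧ r = (enc a, enc b, d, enc a', enc b')}

theorem ruleSet_fin : ruleSet.Finite := by
  have f0 : Finite Cell := Finite.of_fintype Cell
  have f1 : Finite (Cell × Cell) := @Finite.instProd Cell Cell f0 f0
  have f2 : Finite (Fin 4 × Cell × Cell) := @Finite.instProd _ _ inferInstance f1
  have f3 : Finite (Cell × Fin 4 × Cell × Cell) := @Finite.instProd _ _ f0 f2
  have f4 : Finite (Cell × Cell × Fin 4 × Cell × Cell) := @Finite.instProd _ _ f0 f3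
  apply Set.Finite.subset (Set.finite_range
    (fun x : Cell × Cell × Fin 4 × Cell × Cell =>
      (enc x.1, enc x.2.1, x.2.2.1, enc x.2.2.2.1, enc x.2.2.2.2)))
  rintro r ⟨a, b, d, a', b', -, rfl⟩
  exact ⟨(a, b, d, a', b'), rfl⟩

noncomputable def rulesU : Finset (ℕ × ℕ × Fin 4 × ℕ × ℕ) := ruleSet_fin.toFinset

theorem mem_rulesU (r) : r ∈ rulesU ↔
    ∃ a b d a' b', Good a b d a' b' ∧ r = (enc a, enc b, d, enc a', enc b') := by
  simp [rulesU, ruleSet]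

abbrev Rule : Type := ℕ × ℕ × Fin 4 × ℕ × ℕ

def blk (m : ℕ) (p : Pos) : Pos := (p.1 / m, p.2 / m)

def line (m : ℕ) (p : Pos) (d : Fin 4) : ℤ := if ax d then p.2 % m else p.1 % m

def vl (r : Rule) (d : Fin 4) (ro po : Bool) : ℕ :=
  if ro = true then (if po = true ∧ d = r.2.2.1 then r.2.2.2.2 else r.2.1)
  else (if po = true ∧ d = r.2.2.1 then r.2.2.2.1 else r.1)

def g (m : ℕ) (ρ : ℤ → Rule) (p : Pos) (t : Tok) : ℕ :=
  vl (ρ (line m p t.1)) t.1 t.2.1 t.2.2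

def cellAt (m : ℕ) (ρ : ℤ → Rule) (p : Pos) (o : Option Tok) : Cell :=
  (fun t t' => decide (g m ρ p t = g m ρ p t'),
   fun d => decide (blk m (p + dirOffset d) = blk m p), o)

abbrev Macro : Type := Pos → Pos × Tok

def tokAt (m : ℕ) (σ : Macro) (p : Pos) : Option Tok :=
  if (σ (blk m p)).1 = p then some (σ (blk m p)).2 else none

noncomputable def Enc (m : ℕ) (ρ : ℤ → Rule) (σ : Macro) : Config :=
  fun p => enc (cellAt m ρ p (tokAt m σ p))

def Valid (m : ℕ) (σ : Macro) : Prop := ∀ q, blk m (σ q).1 = q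

def rep (m : ℕ) (ρ : ℤ → Rule) (σ : Macro) : Config := fun q => g m ρ (σ q).1 (σ q).2

noncomputable def sys (m : ℕ) (ρ : ℤ → Rule) (σ : Macro) : BPACA where
  states := StU
  rules := rulesU
  init := Enc m ρ σ
  init_states := fun _ => mem_StU _
  rules_states := by
    intro r hr
    obtain ⟨a, b, d, a', b', -, rfl⟩ := (mem_rulesU r).1 hr
    exact ⟨mem_StU _, mem_StU _, mem_StU _, mem_StU _⟩

theorem off_ne (p : Pos) (d : Fin 4) : p + dirOffset d ≠ p := by
  intro h
  have : dirOffset d = 0 := by simpa using h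
  fin_cases d <;> simp [dirOffset] at this

theorem line_off (m : ℕ) (p : Pos) (d d' : Fin 4) (h : ax d' = ax d) :
    line m (p + dirOffset d) d' = line m p d' := by
  simp only [line, h]
  fin_cases d <;> simp [dirOffset, ax]

theorem div_succ (m : ℕ) (hm : 0 < m) (a : ℤ) :
    (a + 1) / (m : ℤ) = a / m ∨ (a + 1) / (m : ℤ) = a / m + 1 := by
  have hm' : (0 : ℤ) < m := by exact_mod_cast hm
  have h1 : a / (m : ℤ) ≤ (a + 1) / m := Int.ediv_le_ediv hm' (by lia)
  have h2 : (a + 1) / (m : ℤ) ≤ (a + 1 * m) / m := Int.ediv_le_ediv hm' (by lia)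
  rw [Int.add_mul_ediv_right _ _ hm'.ne'] at h2
  lia

theorem blk_off (m : ℕ) (hm : 0 < m) (p : Pos) (d : Fin 4) :
    blk m (p + dirOffset d) = blk m p ∨ blk m (p + dirOffset d) = blk m p + dirOffset d := by
  obtain ⟨x, y⟩ := p
  have a := div_succ m hm x
  have b := div_succ m hm (x - 1)
  have c := div_succ m hm y
  have e := div_succ m hm (y - 1)
  simp only [sub_add_cancel] at b e
  fin_cases d <;> simp [dirOffset, blk, ← sub_eq_add_neg] <;> lia

/-- Replacing the token of block `q`. -/
theorem tokAt_update (m : ℕ) (σ : Macro) (q p : Pos) (pt : Pos × Tok) :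
    tokAt m (Function.update σ q pt) p =
      if blk m p = q then (if pt.1 = p then some pt.2 else none) else tokAt m σ p := by
  unfold tokAt
  by_cases h : blk m p = q
  · subst h; simp
  · simp [h]

theorem valid_update {m : ℕ} {σ : Macro} (hσ : Valid m σ) {q : Pos} {pt : Pos × Tok}
    (h : blk m pt.1 = q) : Valid m (Function.update σ q pt) := by
  intro q'
  by_cases hq : q' = q
  · subst hq; simpa using h
  · simpa [Function.update_of_ne hq] using hσ q'

theorem tokAt_some {m : ℕ} {σ : Macro} {p : Pos} {t : Tok} (h : tokAt m σ p = some t) :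
    σ (blk m p) = (p, t) := by
  unfold tokAt at h
  split_ifs at h with h1
  · exact Prod.ext h1 (by simpa using h)

theorem enc_move {m : ℕ} (ρ : ℤ → Rule) {σ : Macro} {p : Pos} {t : Tok} {d : Fin 4}
    (h : tokAt m σ p = some t) (hb : blk m (p + dirOffset d) = blk m p) :
    Enc m ρ (Function.update σ (blk m p) (p + dirOffset d, t)) =
      Function.update (Function.update (Enc m ρ σ) p (enc (cellAt m ρ p none)))
        (p + dirOffset d) (enc (cellAt m ρ (p + dirOffset d) (some t))) := by
  have hs := tokAt_some h
  funext x
  simp only [Enc, tokAt_update, Function.update_apply]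
  by_cases h1 : x = p + dirOffset d
  · subst h1; simp [hb]
  · by_cases h2 : x = p
    · subst h2; simp only [if_neg h1, if_neg (Ne.symm h1), if_true]
    · simp only [h1, h2, if_false]
      by_cases h3 : blk m x = blk m p
      · simp [h3, tokAt, hs, Ne.symm h1, Ne.symm h2]
      · simp [h3]

theorem enc_switch {m : ℕ} (ρ : ℤ → Rule) {σ : Macro} {p : Pos} {t t' : Tok} {d : Fin 4}
    (h : tokAt m σ p = some t) :
    Enc m ρ (Function.update σ (blk m p) (p, t')) =
      Function.update (Function.update (Enc m ρ σ) p (enc (cellAt m ρ p (some t'))))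
        (p + dirOffset d) (Enc m ρ σ (p + dirOffset d)) := by
  have hs := tokAt_some h
  have hn := off_ne p d
  funext x
  simp only [Enc, tokAt_update, Function.update_apply]
  by_cases h2 : x = p
  · subst h2; simp [hn.symm]
  · have : (if blk m x = blk m p then (if p = x then some t' else none) else tokAt m σ x)
        = tokAt m σ x := by
      by_cases h3 : blk m x = blk m p
      · simp [h3, tokAt, hs, Ne.symm h2]
      · simp [h3]
    rw [this]
    by_cases h1 : x = p + dirOffset d
    · subst h1; simp
    · simp [h1, h2]

theorem enc_commit {m : ℕ} (ρ : ℤ → Rule) {σ : Macro} {p p' : Pos} {t t' u u' : Tok}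
    (h : tokAt m σ p = some t) (h' : tokAt m σ p' = some t')
    (hb : blk m p' ≠ blk m p) :
    Enc m ρ (Function.update (Function.update σ (blk m p) (p, u)) (blk m p') (p', u')) =
      Function.update (Function.update (Enc m ρ σ) p (enc (cellAt m ρ p (some u))))
        p' (enc (cellAt m ρ p' (some u'))) := by
  have hs := tokAt_some h
  have hs' := tokAt_some h'
  funext x
  simp only [Enc, tokAt_update, Function.update_apply]
  by_cases h1 : x = p'
  · subst h1; simp
  · by_cases h2 : x = p
    · subst h2; simp [hb.symm, h1]
    · simp only [h1, h2, if_false]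
      by_cases h3 : blk m x = blk m p'
      · simp [h3, tokAt, hs', Ne.symm h1]
      · by_cases h4 : blk m x = blk m p
        · simp [h4, hb.symm, tokAt, hs, Ne.symm h2]
        · simp [h3, h4]

theorem g_off (m : ℕ) (ρ : ℤ → Rule) (p : Pos) (d : Fin 4) (t : Tok) (h : ax t.1 = ax d) :
    g m ρ (p + dirOffset d) t = g m ρ p t := by
  simp only [g, line_off m p d t.1 h]

theorem rep_update (m : ℕ) (ρ : ℤ → Rule) (σ : Macro) (q : Pos) (pt : Pos × Tok) :
    rep m ρ (Function.update σ q pt) = Function.update (rep m ρ σ) q (g m ρ pt.1 pt.2) := by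
  funext x
  simp only [rep, Function.update_apply]
  split_ifs <;> rfl

/-- The hypotheses relating the line labelling to the simulated system. -/
structure Lab (Γ : BPACA) (m : ℕ) (ρ : ℤ → Rule) : Prop where
  pos : 0 < m
  ok : ∀ k : ℤ, 0 ≤ k → k < m → ρ k ∈ Γ.rules ∨ ((ρ k).1 = (ρ k).2.2.2.1 ∧
    (ρ k).2.1 = (ρ k).2.2.2.2)
  surj : ∀ r ∈ Γ.rules, ∃ k : ℤ, 0 ≤ k ∧ k < m ∧ ρ k = r
  st : ∀ s ∈ Γ.states, ∃ k : ℤ, 0 ≤ k ∧ k < m ∧ (ρ k).1 = s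

theorem exists_lab (Γ : BPACA) : ∃ m ρ, Lab Γ m ρ := by
  let S : Finset Rule := Γ.rules ∪ Γ.states.image (fun s => (s, s, 0, s, s))
  let L := S.toList
  have hL : ∀ r, r ∈ L ↔ (r ∈ Γ.rules ∨ ∃ s ∈ Γ.states, (s, s, 0, s, s) = r) := by
    intro r
    simp only [L, S, Finset.mem_toList, Finset.mem_union, Finset.mem_image]
  have hsurj : ∀ r ∈ L, ∃ k : ℤ, 0 ≤ k ∧ k < L.length ∧ L.getD k.toNat (0, 0, 0, 0, 0) = r := by
    intro r hr
    obtain ⟨n, hn, rfl⟩ := List.getElem_of_mem hr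
    exact ⟨n, by lia, by lia, by simp [hn]⟩
  refine ⟨L.length, fun k => L.getD k.toNat (0, 0, 0, 0, 0), ?_, ?_, ?_, ?_⟩
  · apply List.length_pos_of_mem (a := ((Γ.init 0, Γ.init 0, 0, Γ.init 0, Γ.init 0) : Rule))
    exact (hL _).2 (Or.inr ⟨_, Γ.init_states 0, rfl⟩)
  · intro k h0 h1
    have hk : k.toNat < L.length := by lia
    have : L.getD k.toNat (0, 0, 0, 0, 0) ∈ L := by
      rw [List.getD_eq_getElem _ _ hk]; exact List.getElem_mem hk
    rcases (hL _).1 this with h | ⟨s, -, hs⟩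
    · exact Or.inl h
    · right; simp only [← hs]; simp
  · intro r hr
    exact hsurj r ((hL r).2 (Or.inl hr))
  · intro s hs
    obtain ⟨k, h0, h1, h2⟩ := hsurj _ ((hL _).2 (Or.inr ⟨s, hs, rfl⟩))
    exact ⟨k, h0, h1, by simp only [h2]⟩

theorem line_range {m : ℕ} (hm : 0 < m) (p : Pos) (d : Fin 4) :
    0 ≤ line m p d ∧ line m p d < m := by
  have hm' : (0 : ℤ) < m := by exact_mod_cast hm
  unfold line
  split_ifs
  · exact ⟨Int.emod_nonneg _ hm'.ne', Int.emod_lt_of_pos _ hm'⟩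
  · exact ⟨Int.emod_nonneg _ hm'.ne', Int.emod_lt_of_pos _ hm'⟩

theorem cellAt_eq {m : ℕ} {ρ : ℤ → Rule} {p : Pos} {o : Option Tok} {M w o'}
    (h : cellAt m ρ p o = (M, w, o')) :
    M = (fun t t' => decide (g m ρ p t = g m ρ p t')) ∧
    w = (fun d => decide (blk m (p + dirOffset d) = blk m p)) ∧ o = o' := by
  unfold cellAt at h
  simp only [Prod.mk.injEq] at h
  exact ⟨h.1.symm, h.2.1.symm, h.2.2⟩

theorem forward {Γ : BPACA} {m : ℕ} {ρ : ℤ → Rule} (hL : Lab Γ m ρ) (σ0 : Macro)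
    {σ : Macro} (hσ : Valid m σ) {C' : Config} (h : (sys m ρ σ0).StepR (Enc m ρ σ) C') :
    ∃ σ', Valid m σ' ∧ C' = Enc m ρ σ' ∧ Γ.Reach (rep m ρ σ) (rep m ρ σ') := by
  obtain ⟨r, hr, p, h1, h2, h3⟩ := h
  obtain ⟨a, b, d, a', b', hg, rfl⟩ := (mem_rulesU r).1 hr
  simp only at h1 h2 h3
  have e1 := enc_inj h1
  have e2 := enc_inj h2
  clear h1 h2 hr
  cases hg with
  | move M w M' w' t d hax hw =>
    obtain ⟨rfl, rfl, ht⟩ := cellAt_eq e1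
    obtain ⟨rfl, rfl, ht'⟩ := cellAt_eq e2
    have hb : blk m (p + dirOffset d) = blk m p := by simpa using hw
    refine ⟨_, valid_update hσ (pt := (p + dirOffset d, t)) hb, ?_, ?_⟩
    · rw [h3, enc_move ρ ht hb]; rfl
    · rw [rep_update]
      have : Function.update (rep m ρ σ) (blk m p) (g m ρ (p + dirOffset d) t) = rep m ρ σ := by
        rw [g_off _ _ _ _ _ hax, Function.update_eq_self_iff]
        simp [rep, tokAt_some ht]
      rw [this]
      exact Relation.ReflTransGen.refl
  | switch M w k t t' d hM =>
    obtain ⟨rfl, rfl, ht⟩ := cellAt_eq e1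
    subst e2
    have hM' : g m ρ p t = g m ρ p t' := by simpa using hM
    refine ⟨_, valid_update hσ (pt := (p, t')) rfl, ?_, ?_⟩
    · rw [h3, enc_switch (d := d) ρ ht]; rfl
    · rw [rep_update]
      have : Function.update (rep m ρ σ) (blk m p) (g m ρ p t') = rep m ρ σ := by
        rw [← hM', Function.update_eq_self_iff]
        simp [rep, tokAt_some ht]
      rw [this]
      exact Relation.ReflTransGen.refl
  | commit M w M' w' d =>
    obtain ⟨rfl, rfl, ht⟩ := cellAt_eq e1
    obtain ⟨rfl, rfl, ht'⟩ := cellAt_eq e2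
    have s1 := tokAt_some ht
    have s2 := tokAt_some ht'
    have hb : blk m (p + dirOffset d) ≠ blk m p := by
      intro hb
      rw [hb, s1] at s2
      simp at s2
    have hb' := (blk_off m hL.pos p d).resolve_left hb
    refine ⟨_, valid_update (valid_update hσ (pt := (p, (d, false, true))) rfl)
      (pt := (p + dirOffset d, (d, true, true))) rfl, ?_, ?_⟩
    · rw [h3, enc_commit ρ ht ht' hb]; rfl
    · rw [rep_update, rep_update]
      simp only
      have r1 : rep m ρ σ (blk m p) = (ρ (line m p d)).1 := by
        simp [rep, s1, g, vl]
      have r2 : rep m ρ σ (blk m (p + dirOffset d)) = (ρ (line m p d)).2.1 := by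
        simp [rep, s2, g, vl, line_off]
      have key : ∀ x y, g m ρ p (d, false, true) = x →
          g m ρ (p + dirOffset d) (d, true, true) = y →
          ((ρ (line m p d)).1 = x ∧ (ρ (line m p d)).2.1 = y) →
          Γ.Reach (rep m ρ σ) (Function.update (Function.update (rep m ρ σ) (blk m p)
            (g m ρ p (d, false, true))) (blk m (p + dirOffset d))
            (g m ρ (p + dirOffset d) (d, true, true))) := by
        intro x y hx hy ⟨hx', hy'⟩
        rw [hx, hy, ← hx', ← hy', ← r1, ← r2, Function.update_eq_self, Function.update_eq_self]
        exact Relation.ReflTransGen.refl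
      by_cases hd : d = (ρ (line m p d)).2.2.1
      · have g1 : g m ρ p (d, false, true) = (ρ (line m p d)).2.2.2.1 := by
          simp [g, vl, ← hd]
        have g2 : g m ρ (p + dirOffset d) (d, true, true) = (ρ (line m p d)).2.2.2.2 := by
          simp [g, vl, line_off, ← hd]
        rcases hL.ok _ (line_range hL.pos p d).1 (line_range hL.pos p d).2 with hin | ⟨i1, i2⟩
        · apply Relation.ReflTransGen.single
          refine ⟨_, hin, blk m p, r1, ?_, ?_⟩
          · rw [← hd, ← hb', r2]
          · rw [← hd, ← hb', g1, g2]
        · exact key _ _ g1 g2 ⟨i1, i2⟩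
      · refine key (ρ (line m p d)).1 (ρ (line m p d)).2.1 ?_ ?_ ⟨rfl, rfl⟩
        · simp [g, vl, hd]
        · simp [g, vl, line_off, hd]

/-! Token walks. -/

theorem step_move {m : ℕ} {ρ : ℤ → Rule} (σ0 : Macro) {σ : Macro} (hσ : Valid m σ)
    {p : Pos} {t : Tok} {d : Fin 4} (hax : ax t.1 = ax d)
    {q : Pos} (h : σ q = (p, t)) (hb : blk m (p + dirOffset d) = q) :
    (sys m ρ σ0).StepR (Enc m ρ σ) (Enc m ρ (Function.update σ q (p + dirOffset d, t))) := by
  have hq : blk m p = q := by simpa [h] using hσ q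
  have ht : tokAt m σ p = some t := by simp [tokAt, hq, h]
  have hn : tokAt m σ (p + dirOffset d) = none := by
    simp [tokAt, hb, h, (off_ne p d).symm]
  refine ⟨(enc (cellAt m ρ p (some t)), enc (cellAt m ρ (p + dirOffset d) none), d,
    enc (cellAt m ρ p none), enc (cellAt m ρ (p + dirOffset d) (some t))), ?_, p, ?_, ?_, ?_⟩
  · exact (mem_rulesU _).2 ⟨_, _, _, _, _, Good.move _ _ _ _ t d hax (by simp [hb, hq]), rfl⟩
  · simp only [Enc, ht]
  · simp only [Enc, hn]
  · subst hq
    exact enc_move ρ ht hb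

theorem step_switch {m : ℕ} {ρ : ℤ → Rule} (σ0 : Macro) {σ : Macro} (hσ : Valid m σ)
    {p : Pos} {t t' : Tok} (hg : g m ρ p t = g m ρ p t')
    {q : Pos} (h : σ q = (p, t)) :
    (sys m ρ σ0).StepR (Enc m ρ σ) (Enc m ρ (Function.update σ q (p, t'))) := by
  have hq : blk m p = q := by simpa [h] using hσ q
  have ht : tokAt m σ p = some t := by simp [tokAt, hq, h]
  refine ⟨(enc (cellAt m ρ p (some t)), Enc m ρ σ (p + dirOffset 0), 0,
    enc (cellAt m ρ p (some t')), Enc m ρ σ (p + dirOffset 0)), ?_, p, ?_, ?_, ?_⟩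
  · exact (mem_rulesU _).2 ⟨_, _, _, _, _, Good.switch _ _ _ t t' 0 (by simp [hg]), rfl⟩
  · simp only [Enc, ht]
  · rfl
  · subst hq
    exact enc_switch ρ ht

/-- Reachability inside the block `q`: from token position `a` to `b`. -/
def Walk (m : ℕ) (ρ : ℤ → Rule) (σ0 : Macro) (q : Pos) (a b : Pos × Tok) : Prop :=
  blk m b.1 = q ∧ ∀ σ, Valid m σ → σ q = a →
    (sys m ρ σ0).Reach (Enc m ρ σ) (Enc m ρ (Function.update σ q b))

theorem Walk.refl {m : ℕ} {ρ : ℤ → Rule} {σ0 : Macro} {q : Pos} {a : Pos × Tok}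
    (h : blk m a.1 = q) : Walk m ρ σ0 q a a := by
  refine ⟨h, fun σ _ ha => ?_⟩
  rw [← ha, Function.update_eq_self]
  exact Relation.ReflTransGen.refl

theorem Walk.trans {m : ℕ} {ρ : ℤ → Rule} {σ0 : Macro} {q : Pos} {a b c : Pos × Tok}
    (h : Walk m ρ σ0 q a b) (h' : Walk m ρ σ0 q b c) : Walk m ρ σ0 q a c := by
  refine ⟨h'.1, fun σ hσ ha => ?_⟩
  have := h'.2 _ (valid_update hσ h.1) (by simp)
  rw [Function.update_idem] at this
  exact Relation.ReflTransGen.trans (h.2 σ hσ ha) this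

theorem Walk.move {m : ℕ} {ρ : ℤ → Rule} {σ0 : Macro} {q p : Pos} {t : Tok} {d : Fin 4}
    (hax : ax t.1 = ax d) (hb : blk m (p + dirOffset d) = q) :
    Walk m ρ σ0 q (p, t) (p + dirOffset d, t) :=
  ⟨hb, fun _ hσ h => Relation.ReflTransGen.single (step_move σ0 hσ hax h hb)⟩

theorem Walk.switch {m : ℕ} {ρ : ℤ → Rule} {σ0 : Macro} {q p : Pos} {t t' : Tok}
    (hp : blk m p = q) (hg : g m ρ p t = g m ρ p t') :
    Walk m ρ σ0 q (p, t) (p, t') :=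
  ⟨hp, fun _ hσ h => Relation.ReflTransGen.single (step_switch σ0 hσ hg h)⟩

theorem div_mid {m : ℕ} (hm : 0 < m) {a b c : ℤ} (h1 : a ≤ b) (h2 : b ≤ c)
    (h : c / (m : ℤ) = a / m) : b / (m : ℤ) = a / m := by
  have hm' : (0 : ℤ) < m := by exact_mod_cast hm
  have := Int.ediv_le_ediv hm' h1
  have := Int.ediv_le_ediv hm' h2
  lia

theorem Walk.right {m : ℕ} (hm : 0 < m) {ρ : ℤ → Rule} {σ0 : Macro} {t : Tok}
    (ht : ax t.1 = true) (x y : ℤ) (n : ℕ) (h : (x + n) / (m : ℤ) = x / m) :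
    Walk m ρ σ0 (blk m (x, y)) ((x, y), t) ((x + n, y), t) ∧
    Walk m ρ σ0 (blk m (x, y)) ((x + n, y), t) ((x, y), t) := by
  induction n with
  | zero => simpa using Walk.refl (m := m) (ρ := ρ) (σ0 := σ0) (a := ((x, y), t)) rfl
  | succ n ih =>
    have h' := div_mid hm (b := x + n) (by lia) (by push_cast; lia) h
    obtain ⟨i1, i2⟩ := ih h'
    have e1 : ((x + n, y) : Pos) + dirOffset 0 = (x + (n + 1 : ℕ), y) := by
      simp [dirOffset, add_assoc]
    have e2 : ((x + (n + 1 : ℕ), y) : Pos) + dirOffset 1 = (x + n, y) := by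
      simp [dirOffset]; ring
    have w1 := Walk.move (m := m) (ρ := ρ) (σ0 := σ0) (q := blk m (x, y)) (p := (x + n, y))
      (t := t) (d := 0) ht (by rw [e1]; simp only [blk, h])
    have w2 := Walk.move (m := m) (ρ := ρ) (σ0 := σ0) (q := blk m (x, y))
      (p := (x + (n + 1 : ℕ), y)) (t := t) (d := 1) ht (by rw [e2]; simp only [blk, h'])
    rw [e1] at w1
    rw [e2] at w2
    exact ⟨i1.trans w1, w2.trans i2⟩

theorem Walk.up {m : ℕ} (hm : 0 < m) {ρ : ℤ → Rule} {σ0 : Macro} {t : Tok}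
    (ht : ax t.1 = false) (x y : ℤ) (n : ℕ) (h : (y + n) / (m : ℤ) = y / m) :
    Walk m ρ σ0 (blk m (x, y)) ((x, y), t) ((x, y + n), t) ∧
    Walk m ρ σ0 (blk m (x, y)) ((x, y + n), t) ((x, y), t) := by
  induction n with
  | zero => simpa using Walk.refl (m := m) (ρ := ρ) (σ0 := σ0) (a := ((x, y), t)) rfl
  | succ n ih =>
    have h' := div_mid hm (b := y + n) (by lia) (by push_cast; lia) h
    obtain ⟨i1, i2⟩ := ih h'
    have e1 : ((x, y + n) : Pos) + dirOffset 2 = (x, y + (n + 1 : ℕ)) := by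
      simp [dirOffset, add_assoc]
    have e2 : ((x, y + (n + 1 : ℕ)) : Pos) + dirOffset 3 = (x, y + n) := by
      simp [dirOffset]; ring
    have w1 := Walk.move (m := m) (ρ := ρ) (σ0 := σ0) (q := blk m (x, y)) (p := (x, y + n))
      (t := t) (d := 2) ht (by rw [e1]; simp only [blk, h])
    have w2 := Walk.move (m := m) (ρ := ρ) (σ0 := σ0) (q := blk m (x, y))
      (p := (x, y + (n + 1 : ℕ))) (t := t) (d := 3) ht (by rw [e2]; simp only [blk, h'])
    rw [e1] at w1
    rw [e2] at w2
    exact ⟨i1.trans w1, w2.trans i2⟩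

theorem Walk.horiz {m : ℕ} (hm : 0 < m) {ρ : ℤ → Rule} {σ0 : Macro} {t : Tok}
    (ht : ax t.1 = true) {q : Pos} {x x' y : ℤ} (h : blk m (x, y) = q) (h' : blk m (x', y) = q) :
    Walk m ρ σ0 q ((x, y), t) ((x', y), t) := by
  have e : x / (m : ℤ) = x' / m := congrArg Prod.fst (h.trans h'.symm)
  rcases le_total x x' with hl | hl
  · obtain ⟨n, rfl⟩ := Int.le.dest hl
    subst h
    exact (Walk.right hm ht x y n e.symm).1
  · obtain ⟨n, rfl⟩ := Int.le.dest hl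
    subst h'
    exact (Walk.right hm ht x' y n e).2

theorem Walk.vert {m : ℕ} (hm : 0 < m) {ρ : ℤ → Rule} {σ0 : Macro} {t : Tok}
    (ht : ax t.1 = false) {q : Pos} {x y y' : ℤ} (h : blk m (x, y) = q) (h' : blk m (x, y') = q) :
    Walk m ρ σ0 q ((x, y), t) ((x, y'), t) := by
  have e : y / (m : ℤ) = y' / m := congrArg Prod.snd (h.trans h'.symm)
  rcases le_total y y' with hl | hl
  · obtain ⟨n, rfl⟩ := Int.le.dest hl
    subst h
    exact (Walk.up hm ht x y n e.symm).1
  · obtain ⟨n, rfl⟩ := Int.le.dest hl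
    subst h'
    exact (Walk.up hm ht x y' n e).2

theorem g_pre (m : ℕ) (ρ : ℤ → Rule) (p : Pos) (d : Fin 4) (ro : Bool) :
    g m ρ p (d, ro, false) = if ro = true then (ρ (line m p d)).2.1 else (ρ (line m p d)).1 := by
  simp [g, vl]

theorem dm {m : ℕ} {a k : ℤ} (h0 : 0 ≤ k) (h1 : k < m) :
    (m * a + k) / (m : ℤ) = a ∧ (m * a + k) % (m : ℤ) = k := by
  have hm : (m : ℤ) ≠ 0 := by lia
  constructor
  · rw [add_comm, Int.add_mul_ediv_left _ _ hm, Int.ediv_eq_zero_of_lt h0 h1, zero_add]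
  · rw [add_comm, Int.add_mul_emod_self_left, Int.emod_eq_of_lt h0 h1]

/-- From anywhere in the block, walk to the diagonal cell of line `k`. -/
theorem Walk.diag {m : ℕ} (hm : 0 < m) {ρ : ℤ → Rule} {σ0 : Macro} {q p : Pos} {t : Tok}
    (hp : blk m p = q) {k : ℤ} (h0 : 0 ≤ k) (h1 : k < m) (D : Fin 4) (ro : Bool)
    (hg : g m ρ p t = if ro = true then (ρ k).2.1 else (ρ k).1) :
    Walk m ρ σ0 q (p, t) ((m * q.1 + k, m * q.2 + k), (D, ro, false)) := by
  obtain ⟨x, y⟩ := p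
  obtain ⟨a, b⟩ := q
  obtain ⟨a1, a2⟩ := dm (a := a) h0 h1
  obtain ⟨b1, b2⟩ := dm (a := b) h0 h1
  have hx : x / (m : ℤ) = a := congrArg Prod.fst hp
  have hy : y / (m : ℤ) = b := congrArg Prod.snd hp
  have hkk : blk m (m * a + k, m * b + k) = (a, b) := by simp [blk, a1, b1]
  have last : ∀ d : Fin 4, Walk m ρ σ0 (a, b) ((m * a + k, m * b + k), (d, ro, false))
      ((m * a + k, m * b + k), (D, ro, false)) := by
    intro d
    apply Walk.switch hkk
    simp [g_pre, line, a2, b2]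
  cases ht : ax t.1 with
  | true =>
    have c1 : blk m (m * a + k, y) = (a, b) := by simp [blk, a1, hy]
    have s1 : Walk m ρ σ0 (a, b) ((x, y), t) ((m * a + k, y), t) := Walk.horiz hm ht hp c1
    have s2 : Walk m ρ σ0 (a, b) ((m * a + k, y), t) ((m * a + k, y), (2, ro, false)) := by
      apply Walk.switch c1
      rw [g_pre]
      simp only [line, ax, a2]
      rw [← show g m ρ (x, y) t = g m ρ (m * a + k, y) t by simp [g, line, ht], hg]
      simp
    have s3 : Walk m ρ σ0 (a, b) ((m * a + k, y), (2, ro, false))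
      ((m * a + k, m * b + k), (2, ro, false)) := Walk.vert hm rfl c1 hkk
    exact ((s1.trans s2).trans s3).trans (last 2)
  | false =>
    have c1 : blk m (x, m * b + k) = (a, b) := by simp [blk, b1, hx]
    have s1 : Walk m ρ σ0 (a, b) ((x, y), t) ((x, m * b + k), t) := Walk.vert hm ht hp c1
    have s2 : Walk m ρ σ0 (a, b) ((x, m * b + k), t) ((x, m * b + k), (0, ro, false)) := by
      apply Walk.switch c1
      rw [g_pre]
      simp only [line, ax, b2]
      rw [← show g m ρ (x, y) t = g m ρ (x, m * b + k) t by simp [g, line, ht], hg]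
      simp
    have s3 : Walk m ρ σ0 (a, b) ((x, m * b + k), (0, ro, false))
      ((m * a + k, m * b + k), (0, ro, false)) := Walk.horiz hm rfl c1 hkk
    exact ((s1.trans s2).trans s3).trans (last 0)

/-- Boundary cell of block `q` on side `d` on line `k`. -/
def bd (m : ℕ) (q : Pos) (k : ℤ) : Fin 4 → Pos
  | 0 => (m * q.1 + (m - 1), m * q.2 + k)
  | 1 => (m * q.1 + 0, m * q.2 + k)
  | 2 => (m * q.1 + k, m * q.2 + (m - 1))
  | 3 => (m * q.1 + k, m * q.2 + 0)

/-- The opposite boundary cell. -/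
def bd' (m : ℕ) (q : Pos) (k : ℤ) : Fin 4 → Pos
  | 0 => bd m q k 1
  | 1 => bd m q k 0
  | 2 => bd m q k 3
  | 3 => bd m q k 2

theorem bd_off (m : ℕ) (q : Pos) (k : ℤ) (d : Fin 4) :
    bd m q k d + dirOffset d = bd' m (q + dirOffset d) k d := by
  fin_cases d <;> simp [bd, bd', dirOffset] <;> ring

theorem blk_bd {m : ℕ} (hm : 0 < m) (q : Pos) {k : ℤ} (h0 : 0 ≤ k) (h1 : k < m) (d : Fin 4) :
    blk m (bd m q k d) = q := by
  have hk := fun a => (dm (a := a) h0 h1).1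
  have hz := fun a => (dm (m := m) (a := a) (k := 0) (by lia) (by lia)).1
  have hl := fun a => (dm (m := m) (a := a) (k := m - 1) (by lia) (by lia)).1
  fin_cases d <;> simp only [bd, blk, hk, hz, hl]

theorem blk_bd' {m : ℕ} (hm : 0 < m) (q : Pos) {k : ℤ} (h0 : 0 ≤ k) (h1 : k < m) (d : Fin 4) :
    blk m (bd' m q k d) = q := by
  fin_cases d <;> exact blk_bd hm q h0 h1 _

theorem line_bd {m : ℕ} (q : Pos) {k : ℤ} (h0 : 0 ≤ k) (h1 : k < m) (d : Fin 4) :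
    line m (bd m q k d) d = k := by
  have hk := fun a => (dm (a := a) h0 h1).2
  fin_cases d <;> simp only [line, ax, bd, hk] <;> simp

theorem Walk.bd {m : ℕ} (hm : 0 < m) {ρ : ℤ → Rule} {σ0 : Macro} {q p : Pos} {t : Tok}
    (hp : blk m p = q) {k : ℤ} (h0 : 0 ≤ k) (h1 : k < m) (D D' : Fin 4) (hD : ax D = ax D')
    (ro : Bool) (hg : g m ρ p t = if ro = true then (ρ k).2.1 else (ρ k).1) :
    Walk m ρ σ0 q (p, t) (IU.bd m q k D', (D, ro, false)) := by
  have w := Walk.diag (σ0 := σ0) hm hp h0 h1 D ro hg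
  refine w.trans ?_
  have hb := blk_bd hm q h0 h1 D'
  have hw := w.1
  fin_cases D'
  · exact Walk.horiz hm hD hw hb
  · exact Walk.horiz hm hD hw hb
  · exact Walk.vert hm hD hw hb
  · exact Walk.vert hm hD hw hb

theorem backward {Γ : BPACA} {m : ℕ} {ρ : ℤ → Rule} (hL : Lab Γ m ρ) (σ0 : Macro)
    {σ : Macro} (hσ : Valid m σ) {D : Config} (h : Γ.StepR (rep m ρ σ) D) :
    ∃ σ', Valid m σ' ∧ (sys m ρ σ0).Reach (Enc m ρ σ) (Enc m ρ σ') ∧ rep m ρ σ' = D := by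
  obtain ⟨r, hr, q, h1, h2, h3⟩ := h
  obtain ⟨k, k0, k1, rfl⟩ := hL.surj r hr
  have hm := hL.pos
  generalize hd : (ρ k).2.2.1 = d at h2 h3
  have hqn : q + dirOffset d ≠ q := off_ne q d
  -- first walk
  have w1 : Walk m ρ σ0 q (σ q) (bd m q k d, (d, false, false)) := by
    apply Walk.bd hm (hσ q) k0 k1 d d rfl
    simpa [rep] using h1
  have w2 : Walk m ρ σ0 (q + dirOffset d) (σ (q + dirOffset d))
      (bd' m (q + dirOffset d) k d, (d, true, false)) := by
    have := fun D' hD => Walk.bd (ρ := ρ) (σ0 := σ0) hm (hσ (q + dirOffset d)) k0 k1 d D' hD true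
      (t := (σ (q + dirOffset d)).2) (by simpa [rep] using h2)
    clear hd h1 h2 h3 w1 hqn
    fin_cases d
    · exact this 1 rfl
    · exact this 0 rfl
    · exact this 3 rfl
    · exact this 2 rfl
  set p := bd m q k d with hpdef
  have hp' : bd' m (q + dirOffset d) k d = p + dirOffset d := (bd_off m q k d).symm
  rw [hp'] at w2
  have v1 := valid_update hσ w1.1
  have R1 := w1.2 σ hσ rfl
  have R2 := w2.2 _ v1 (by rw [Function.update_of_ne hqn])
  have v2 := valid_update v1 w2.1
  set τ := Function.update (Function.update σ q (p, ((d, false, false) : Tok)))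
    (q + dirOffset d) (p + dirOffset d, ((d, true, false) : Tok)) with hτ
  have b1 : blk m p = q := w1.1
  have b2 : blk m (p + dirOffset d) = q + dirOffset d := w2.1
  have ht : tokAt m τ p = some (d, false, false) := by
    simp [tokAt, b1, hτ, Function.update_of_ne hqn.symm]
  have ht' : tokAt m τ (p + dirOffset d) = some (d, true, false) := by
    simp [tokAt, b2, hτ]
  have v3 := valid_update (valid_update v2 (pt := (p, (d, false, true))) rfl)
    (pt := (p + dirOffset d, (d, true, true))) rfl
  refine ⟨_, v3, ?_, ?_⟩
  · refine Relation.ReflTransGen.tail (Relation.ReflTransGen.trans R1 R2) ?_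
    refine ⟨(enc (cellAt m ρ p (some (d, false, false))),
      enc (cellAt m ρ (p + dirOffset d) (some (d, true, false))), d,
      enc (cellAt m ρ p (some (d, false, true))),
      enc (cellAt m ρ (p + dirOffset d) (some (d, true, true)))), ?_, p, ?_, ?_, ?_⟩
    · exact (mem_rulesU _).2 ⟨_, _, _, _, _, Good.commit _ _ _ _ d, rfl⟩
    · simp only [Enc, ht]
    · simp only [Enc, ht']
    · exact enc_commit ρ ht ht' (by rw [b1, b2]; exact hqn)
  · have hl : line m p d = k := line_bd q k0 k1 d
    rw [h3, rep_update, rep_update, hτ, rep_update, rep_update, b1, b2]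
    have g1 : g m ρ p (d, false, true) = (ρ k).2.2.2.1 := by
      simp [g, vl, hl, hd]
    have g2 : g m ρ (p + dirOffset d) (d, true, true) = (ρ k).2.2.2.2 := by
      simp [g, vl, line_off, hl, hd]
    simp only [g1, g2]
    funext x
    simp only [Function.update_apply]
    split_ifs <;> rfl

/-- The representation function. -/
noncomputable def Rf (m : ℕ) (ρ : ℤ → Rule) : CBlock m → ℕ := fun B =>
  sInf {n | ∃ ij t M w, B ij = enc (M, w, some t) ∧
    n = g m ρ ((ij.1.1 : ℤ), (ij.2.1 : ℤ)) t}

theorem repMap {m : ℕ} (hm : 0 < m) (ρ : ℤ → Rule) {σ : Macro} (hσ : Valid m σ) :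
    CRepMap m (Rf m ρ) (Enc m ρ σ) (rep m ρ σ) := by
  intro X Y
  have hm' : (0 : ℤ) < m := by exact_mod_cast hm
  have hb : ∀ ij : Fin m × Fin m,
      blk m ((m : ℤ) * X + (ij.1.1 : ℤ), (m : ℤ) * Y + (ij.2.1 : ℤ)) = (X, Y) := by
    intro ij
    simp only [blk, (dm (m := m) (k := (ij.1.1 : ℤ)) (by lia) (by have := ij.1.2; lia)).1,
      (dm (m := m) (k := (ij.2.1 : ℤ)) (by lia) (by have := ij.2.2; lia)).1]
  have hgl : ∀ (ij : Fin m × Fin m) t,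
      g m ρ ((m : ℤ) * X + (ij.1.1 : ℤ), (m : ℤ) * Y + (ij.2.1 : ℤ)) t =
      g m ρ ((ij.1.1 : ℤ), (ij.2.1 : ℤ)) t := by
    intro ij t
    simp [g, line]
  have : {n | ∃ ij t M w, cblockAt m (Enc m ρ σ) X Y ij = enc (M, w, some t) ∧
      n = g m ρ ((ij.1.1 : ℤ), (ij.2.1 : ℤ)) t} = {rep m ρ σ (X, Y)} := by
    ext n
    simp only [Set.mem_ofPred_eq, Set.mem_singleton_iff]
    constructor
    · rintro ⟨ij, t, M, w, h, rfl⟩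
      have h' := (cellAt_eq (enc_inj h)).2.2
      have := tokAt_some h'
      rw [hb] at this
      rw [← hgl]
      simp [rep, this]
    · rintro rfl
      have hv := hσ (X, Y)
      rcases hs : σ (X, Y) with ⟨⟨x, y⟩, t⟩
      rw [hs] at hv
      have hx : x / (m : ℤ) = X := congrArg Prod.fst hv
      have hy : y / (m : ℤ) = Y := congrArg Prod.snd hv
      have x0 := Int.emod_nonneg x hm'.ne'
      have x1 := Int.emod_lt_of_pos x hm'
      have y0 := Int.emod_nonneg y hm'.ne'
      have y1 := Int.emod_lt_of_pos y hm'
      have ex : (m : ℤ) * X + ((x % m).toNat : ℤ) = x := by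
        rw [Int.toNat_of_nonneg x0, ← hx, Int.mul_ediv_add_emod]
      have ey : (m : ℤ) * Y + ((y % m).toNat : ℤ) = y := by
        rw [Int.toNat_of_nonneg y0, ← hy, Int.mul_ediv_add_emod]
      refine ⟨(⟨(x % m).toNat, by lia⟩, ⟨(y % m).toNat, by lia⟩), t,
        (cellAt m ρ (x, y) none).1, (cellAt m ρ (x, y) none).2.1, ?_, ?_⟩
      · simp only [cblockAt, ex, ey, Enc]
        have : tokAt m σ (x, y) = some t := by
          have hv' : blk m (x, y) = (X, Y) := hv
          simp [tokAt, hv', hs]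
        rw [this]; rfl
      · rw [← hgl]
        simp only [ex, ey, rep, hs]
  rw [Rf, this, csInf_singleton]

theorem repMap_unique {m : ℕ} {R : CBlock m → ℕ} {C D D' : Config} (h : CRepMap m R C D)
    (h' : CRepMap m R C D') : D = D' := by
  funext ⟨x, y⟩
  rw [h x y, h' x y]

theorem main (Γ : BPACA) : ∃ ΓS : BPACA, ΓS.states = StU ∧ ΓS.rules = rulesU ∧
    ∃ (m : ℕ) (R : CBlock m → ℕ), BPACASimulates m R ΓS Γ := by
  obtain ⟨m, ρ, hL⟩ := exists_lab Γ
  have hm := hL.pos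
  have hinit : ∃ σ0 : Macro, Valid m σ0 ∧ rep m ρ σ0 = Γ.init := by
    choose k k0 k1 k2 using fun q => hL.st _ (Γ.init_states q)
    refine ⟨fun q => (bd m q (k q) 0, (0, false, false)), ?_, ?_⟩
    · intro q
      exact blk_bd hm q (k0 q) (k1 q) 0
    · funext q
      simp only [rep, g_pre, line_bd q (k0 q) (k1 q) 0]
      simpa using k2 q
  obtain ⟨σ0, hv0, hr0⟩ := hinit
  have F : ∀ σ, Valid m σ → ∀ C', (sys m ρ σ0).Reach (Enc m ρ σ) C' →
      ∃ σ', Valid m σ' ∧ C' = Enc m ρ σ' ∧ Γ.Reach (rep m ρ σ) (rep m ρ σ') := by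
    intro σ hσ C' h
    induction h with
    | refl => exact ⟨σ, hσ, rfl, Relation.ReflTransGen.refl⟩
    | tail _ hs ih =>
      obtain ⟨τ, hτ, rfl, hr⟩ := ih
      obtain ⟨τ', hτ', e, hr'⟩ := forward hL σ0 hτ hs
      exact ⟨τ', hτ', e, Relation.ReflTransGen.trans hr hr'⟩
  have B : ∀ σ, Valid m σ → ∀ D, Γ.Reach (rep m ρ σ) D →
      ∃ σ', Valid m σ' ∧ (sys m ρ σ0).Reach (Enc m ρ σ) (Enc m ρ σ') ∧ rep m ρ σ' = D := by
    intro σ hσ D h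
    induction h with
    | refl => exact ⟨σ, hσ, Relation.ReflTransGen.refl, rfl⟩
    | tail _ hs ih =>
      obtain ⟨τ, hτ, hr, rfl⟩ := ih
      obtain ⟨τ', hτ', hr', e⟩ := backward hL σ0 hτ hs
      exact ⟨τ', hτ', Relation.ReflTransGen.trans hr hr', e⟩
  refine ⟨sys m ρ σ0, rfl, rfl, m, Rf m ρ, hm, ?_, ?_, ?_, ?_⟩
  · intro C' h
    obtain ⟨σ, hσ, rfl, hr⟩ := F σ0 hv0 C' h
    rw [hr0] at hr
    exact ⟨_, hr, repMap hm ρ hσ⟩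
  · intro C h
    have h' : Γ.Reach (rep m ρ σ0) C := by rw [hr0]; exact h
    obtain ⟨σ, hσ, hr, rfl⟩ := B σ0 hv0 C h'
    exact ⟨_, hr, repMap hm ρ hσ⟩
  · intro C' D' h h' C D hC hD
    obtain ⟨σ, hσ, rfl, -⟩ := F σ0 hv0 C' h
    obtain ⟨τ, hτ, rfl, hr⟩ := F σ hσ D' h'
    rw [repMap_unique hC (repMap hm ρ hσ), repMap_unique hD (repMap hm ρ hτ)]
    exact hr
  · intro C D _ h C' h' hC
    obtain ⟨σ, hσ, rfl, -⟩ := F σ0 hv0 C' h'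
    rw [repMap_unique hC (repMap hm ρ hσ)] at h
    obtain ⟨τ, hτ, hr, rfl⟩ := B σ hσ D h
    exact ⟨_, hr, repMap hm ρ hτ⟩

end IU

/-- The block-pairwise ACA model is strongly (non-committally)
intrinsically universal: there is a fixed block-pairwise ACA rule set such that every
block-pairwise ACA system is non-committally simulated, under a block representation
function, by a system using that fixed rule set with a suitable initial configuration. -/
theorem blockPairwiseACAisIU :
    ∃ (StU : Finset ℕ) (rulesU : Finset (ℕ × ℕ × Fin 4 × ℕ × ℕ)),
      ∀ ΓT : BPACA,
        ∃ ΓS : BPACA, ΓS.states = StU ∧ ΓS.rules = rulesU ∧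
          ∃ (m : ℕ) (R : CBlock m → ℕ), BPACASimulates m R ΓS ΓT := by
  exact ⟨IU.StU, IU.rulesU, IU.main⟩
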